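/- Let ℤ₄ = ℤ/4ℤ, let Xℤ₄[X] be the additive group of polynomials over ℤ₄ with zero constant term, let H = {2p(X²) − 2p(X) : p ∈ Xℤ₄[X]}, and let G = Xℤ₄[X]/H. Reduction of coefficients modulo 2 sends every element of H to zero, hence induces a well-defined additive homomorphism π : G → X𝔽₂[X]. Define S : G × X𝔽₂[X] → G × X𝔽₂[X] by S(x, y) = (x, π(x) + y). Then S is an additive group automorphism satisfying S ∘ S = id, S fixes every element of the form 2·v for v ∈ G × X𝔽₂[X], and S is not the identity map. -/

import Mathlib

open Polynomial

/-- The additive group `Xℤ₄[X]` of polynomials over `ℤ₄ = ℤ/4ℤ` with zero constant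
term, as an additive subgroup of `ℤ₄[X]`. -/
noncomputable def Xpoly4 : AddSubgroup (Polynomial (ZMod 4)) where
  carrier := {f | f.coeff 0 = 0}
  zero_mem' := by simp
  add_mem' := by
    intro a b ha hb
    simp only [Set.mem_setOf_eq, coeff_add] at *
    simp [ha, hb]
  neg_mem' := by
    intro a ha
    simp only [Set.mem_setOf_eq, coeff_neg] at *
    simp [ha]

/-- The additive subgroup `H = {2p(X²) − 2p(X) : p ∈ Xℤ₄[X]}` of `Xℤ₄[X]`, the image of
the additive homomorphism `p(X) ↦ 2p(X²) − 2p(X)`. -/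
noncomputable def Hsub : AddSubgroup Xpoly4 where
  carrier := {q | ∃ p : Polynomial (ZMod 4), p.coeff 0 = 0 ∧
    (q : Polynomial (ZMod 4)) = 2 * p.comp (X ^ 2) - 2 * p}
  zero_mem' := ⟨0, by simp⟩
  add_mem' := by
    rintro a b ⟨p, hp, hp2⟩ ⟨q, hq, hq2⟩
    refine ⟨p + q, by simp [coeff_add, hp, hq], ?_⟩
    push_cast [hp2, hq2, add_comp]
    ring
  neg_mem' := by
    rintro a ⟨p, hp, hp2⟩
    refine ⟨-p, by simp [coeff_neg, hp], ?_⟩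
    push_cast [hp2, neg_comp]
    ring

/-- The quotient group `G = Xℤ₄[X]/H` of the Connolly–Davis computation. -/
abbrev G12 : Type := Xpoly4 ⧸ Hsub

/-- The additive group `X𝔽₂[X]` of polynomials over `𝔽₂ = ℤ/2ℤ` with zero constant
term, as an additive subgroup of `𝔽₂[X]`. -/
noncomputable def XpolyF2 : AddSubgroup (Polynomial (ZMod 2)) where
  carrier := {f | f.coeff 0 = 0}
  zero_mem' := by simp
  add_mem' := by
    intro a b ha hb
    simp only [Set.mem_setOf_eq, coeff_add] at *
    simp [ha, hb]
  neg_mem' := by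
    intro a ha
    simp only [Set.mem_setOf_eq, coeff_neg] at *
    simp [ha]

/-- Coefficient reduction modulo 2, from `ℤ₄[X]` to `𝔽₂[X]`. -/
noncomputable def red42 (f : Polynomial (ZMod 4)) : Polynomial (ZMod 2) :=
  Polynomial.map (ZMod.castHom (by norm_num : (2 : ℕ) ∣ 4) (ZMod 2)) f

theorem red42_eq_zero_of_mem_Hsub (q : Xpoly4) (hq : q ∈ Hsub) :
    red42 (q : Polynomial (ZMod 4)) = 0 := by
  obtain ⟨p, -, hp⟩ := hq
  simp [red42, hp, Polynomial.map_sub, Polynomial.map_mul, CharTwo.two_eq_zero]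

/-- Coefficient reduction modulo 2 as a homomorphism `Xℤ₄[X] → X𝔽₂[X]`. -/
noncomputable def red42Hom : Xpoly4 →+ XpolyF2 where
  toFun f := ⟨red42 f, by
    have h : (f : Polynomial (ZMod 4)).coeff 0 = 0 := f.2
    change (red42 f).coeff 0 = 0
    simp [red42, h]⟩
  map_zero' := Subtype.ext (by simp [red42])
  map_add' f g := Subtype.ext (by simp [red42])

/-- The homomorphism `π : G → X𝔽₂[X]` induced by coefficient reduction. -/
noncomputable def quotientRed42 : G12 →+ XpolyF2 :=
  QuotientAddGroup.lift Hsub red42Hom fun q hq =>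
    Subtype.ext (red42_eq_zero_of_mem_Hsub q hq)

theorem XpolyF2_add_self (y : XpolyF2) : y + y = 0 :=
  Subtype.ext (CharTwo.add_self_eq_zero (y : Polynomial (ZMod 2)))

/-- The shear `(x, y) ↦ (x, π x + y)` of `A × B`, for `B` of exponent two. -/
def shearEquiv {A B : Type*} [AddCommGroup A] [AddCommGroup B] (π : A →+ B)
    (hB : ∀ y : B, y + y = 0) : (A × B) ≃+ (A × B) where
  toFun v := (v.1, π v.1 + v.2)
  invFun v := (v.1, π v.1 + v.2)
  left_inv v := Prod.ext rfl (by simp [← add_assoc, hB])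
  right_inv v := Prod.ext rfl (by simp [← add_assoc, hB])
  map_add' v w := Prod.ext rfl (by simp [add_add_add_comm])

/-- Coefficient reduction mod 2 kills `H = {2p(X²) − 2p(X)}` and hence induces an additive
homomorphism `π : G = Xℤ₄[X]/H → X𝔽₂[X]`.  The map `S(x, y) = (x, π(x) + y)` on
`G × X𝔽₂[X] ≅ UNil₃(ℤ;ℤ,ℤ)` (the switch involution of the paper) is an additive group
automorphism which is an involution, fixes every element divisible by two, and is not the
identity. -/
theorem switch_involution_exists :
    (∀ q : Xpoly4, q ∈ Hsub → red42 (q : Polynomial (ZMod 4)) = 0) ∧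
    ∃ π : G12 →+ XpolyF2,
      (∀ f : Xpoly4,
        ((π (QuotientAddGroup.mk f) : XpolyF2) : Polynomial (ZMod 2)) =
          red42 (f : Polynomial (ZMod 4))) ∧
      ∃ S : (G12 × XpolyF2) ≃+ (G12 × XpolyF2),
        (∀ v : G12 × XpolyF2, S v = (v.1, π v.1 + v.2)) ∧
        (∀ v : G12 × XpolyF2, S (S v) = v) ∧
        (∀ v : G12 × XpolyF2, S (2 • v) = 2 • v) ∧
        ⇑S ≠ id := by
  refine ⟨red42_eq_zero_of_mem_Hsub, quotientRed42, fun f => rfl,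
    shearEquiv quotientRed42 XpolyF2_add_self, fun v => rfl,
    (shearEquiv quotientRed42 XpolyF2_add_self).left_inv, fun v => ?_, fun h => ?_⟩
  · refine Prod.ext rfl ?_
    change quotientRed42 (2 • v.1) + 2 • v.2 = 2 • v.2
    rw [map_nsmul, two_nsmul (quotientRed42 v.1), XpolyF2_add_self, zero_add]
  · have hX : (X : Polynomial (ZMod 4)) ∈ Xpoly4 := coeff_X_zero
    have hπ : quotientRed42 (QuotientAddGroup.mk ⟨X, hX⟩) + 0 = 0 :=
      congrArg Prod.snd
        (congrFun h ((QuotientAddGroup.mk ⟨X, hX⟩ : G12), (0 : XpolyF2)))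
    rw [add_zero] at hπ
    have hred : red42 (X : Polynomial (ZMod 4)) = 0 := congrArg Subtype.val hπ
    simp [red42] at hred
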